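/- arXiv:2009.11943 — 2 statements merged into one kernel-verified Lean document; each statement's English description precedes it below -/
import Mathlib

section
/- Let σ_x ≥ σ_y > 0 and σ_{k,x} ≥ σ_{k,y} > 0, let μ_k ∈ ℝ² and θ_k ∈ ℝ, and define F(x_s, θ_s) = (1/2)( ln( det Σ(θ_s) / det Σ_k ) + (x_s − μ_k)ᵀ Σ(θ_s)⁻¹ (x_s − μ_k) + tr( Σ(θ_s)⁻¹ Σ_k ) − 2 ) for x_s ∈ ℝ² and θ_s ∈ ℝ. Then (μ_k, θ_k) is a global minimizer of F, i.e. F(x_s, θ_s) ≥ F(μ_k, θ_k) for all x_s ∈ ℝ², θ_s ∈ ℝ, and moreover F(μ_k, θ_k) = (1/2)( ln( σ_x σ_y / (σ_{k,x} σ_{k,y}) ) + (σ_{k,x} σ_y + σ_{k,y} σ_x)/(σ_x σ_y) − 2 ). -/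
open Real Matrix

/-- The 2×2 rotation matrix. -/
noncomputable def rot (θ : ℝ) : Matrix (Fin 2) (Fin 2) ℝ :=
  !![Real.cos θ, -Real.sin θ; Real.sin θ, Real.cos θ]

theorem rot_conj_diag (θ a b : ℝ) : rot θ * !![a, 0; 0, b] * (rot θ)ᵀ =
    !![a * cos θ ^ 2 + b * sin θ ^ 2, (a - b) * (cos θ * sin θ);
      (a - b) * (cos θ * sin θ), a * sin θ ^ 2 + b * cos θ ^ 2] := by
  ext i j
  fin_cases i <;> fin_cases j <;> simp [rot, Matrix.mul_apply, Fin.sum_univ_two] <;> ring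

theorem rot_mul_transpose_self (θ : ℝ) : rot θ * (rot θ)ᵀ = 1 := by
  ext i j
  fin_cases i <;> fin_cases j <;> simp [rot, Matrix.mul_apply, Fin.sum_univ_two] <;>
    first | ring1 | linear_combination Real.sin_sq_add_cos_sq θ

theorem rot_conj_diag_inv (θ : ℝ) {a b : ℝ} (ha : a ≠ 0) (hb : b ≠ 0) :
    (rot θ * !![a, 0; 0, b] * (rot θ)ᵀ)⁻¹ = rot θ * !![a⁻¹, 0; 0, b⁻¹] * (rot θ)ᵀ := by
  apply Matrix.inv_eq_right_inv
  have hR : (rot θ)ᵀ * rot θ = 1 := mul_eq_one_comm.mp (rot_mul_transpose_self θ)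
  have hD : !![a, 0; 0, b] * !![a⁻¹, 0; 0, b⁻¹] = (1 : Matrix (Fin 2) (Fin 2) ℝ) := by
    simp [Matrix.one_fin_two, ha, hb]
  calc rot θ * !![a, 0; 0, b] * (rot θ)ᵀ * (rot θ * !![a⁻¹, 0; 0, b⁻¹] * (rot θ)ᵀ)
      = rot θ * !![a, 0; 0, b] * ((rot θ)ᵀ * rot θ) * !![a⁻¹, 0; 0, b⁻¹] * (rot θ)ᵀ := by
        simp only [Matrix.mul_assoc]
    _ = rot θ * (!![a, 0; 0, b] * !![a⁻¹, 0; 0, b⁻¹]) * (rot θ)ᵀ := by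
        simp only [hR, Matrix.mul_one, Matrix.mul_assoc]
    _ = 1 := by rw [hD, Matrix.mul_one, rot_mul_transpose_self]

theorem det_rot_conj_diag (θ a b : ℝ) :
    (rot θ * !![a, 0; 0, b] * (rot θ)ᵀ).det = a * b := by
  have h : (rot θ).det = 1 := by
    rw [rot, Matrix.det_fin_two_of]
    linear_combination Real.sin_sq_add_cos_sq θ
  rw [Matrix.det_mul, Matrix.det_mul, Matrix.det_transpose, h, Matrix.det_fin_two_of]
  ring

theorem trace_rot_conj_diag_mul (θ φ p q a b : ℝ) :
    (rot θ * !![p, 0; 0, q] * (rot θ)ᵀ * (rot φ * !![a, 0; 0, b] * (rot φ)ᵀ)).trace =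
      p * a + q * b + (a - b) * (q - p) * sin (θ - φ) ^ 2 := by
  rw [rot_conj_diag, rot_conj_diag, Real.sin_sub, Matrix.trace_fin_two]
  simp only [Matrix.mul_apply, Fin.sum_univ_two, Matrix.of_apply, Matrix.cons_val_zero,
    Matrix.cons_val_one, Matrix.cons_val', Matrix.cons_val_fin_one]
  have hθ := Real.cos_sq' θ
  have hφ := Real.cos_sq' φ
  ring_nf
  simp only [hθ, hφ]
  ring

theorem rot_conj_diag_quadratic_nonneg (θ : ℝ) {p q : ℝ} (hp : 0 ≤ p) (hq : 0 ≤ q)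
    (v : Fin 2 → ℝ) : 0 ≤ v ⬝ᵥ ((rot θ * !![p, 0; 0, q] * (rot θ)ᵀ) *ᵥ v) := by
  have h : v ⬝ᵥ ((rot θ * !![p, 0; 0, q] * (rot θ)ᵀ) *ᵥ v) =
      p * (cos θ * v 0 + sin θ * v 1) ^ 2 + q * (sin θ * v 0 - cos θ * v 1) ^ 2 := by
    rw [rot_conj_diag]
    simp [dotProduct, Matrix.mulVec, Fin.sum_univ_two]
    ring
  rw [h]
  positivity

theorem stmt0 (σx σy σkx σky : ℝ) (h1 : σx ≥ σy) (h2 : σy > 0)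
    (h3 : σkx ≥ σky) (h4 : σky > 0)
    (μk : Fin 2 → ℝ) (θk : ℝ)
    (Sig : ℝ → Matrix (Fin 2) (Fin 2) ℝ)
    (hSig : ∀ θs, Sig θs = rot θs * !![σx, 0; 0, σy] * (rot θs)ᵀ)
    (Sigk : Matrix (Fin 2) (Fin 2) ℝ)
    (hSigk : Sigk = rot θk * !![σkx, 0; 0, σky] * (rot θk)ᵀ)
    (F : (Fin 2 → ℝ) → ℝ → ℝ)
    (hF : ∀ xs θs, F xs θs = (1 / 2) * (Real.log ((Sig θs).det / Sigk.det)
      + (xs - μk) ⬝ᵥ ((Sig θs)⁻¹ *ᵥ (xs - μk))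
      + ((Sig θs)⁻¹ * Sigk).trace - 2)) :
    (∀ (xs : Fin 2 → ℝ) (θs : ℝ), F xs θs ≥ F μk θk) ∧
    F μk θk = (1 / 2) * (Real.log (σx * σy / (σkx * σky))
      + (σkx * σy + σky * σx) / (σx * σy) - 2) := by
  have hx : 0 < σx := h2.trans_le h1
  have hval : F μk θk = (1 / 2) * (Real.log (σx * σy / (σkx * σky))
      + (σkx * σy + σky * σx) / (σx * σy) - 2) := by
    rw [hF, hSig, hSigk, rot_conj_diag_inv _ hx.ne' h2.ne', trace_rot_conj_diag_mul,
      det_rot_conj_diag, det_rot_conj_diag, sub_self, sub_self, Real.sin_zero, zero_dotProduct]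
    field_simp
    ring
  refine ⟨fun xs θs => ?_, hval⟩
  have hquad := rot_conj_diag_quadratic_nonneg θs (inv_nonneg.mpr hx.le) (inv_nonneg.mpr h2.le)
    (xs - μk)
  have htrace : 0 ≤ (σkx - σky) * (σy⁻¹ - σx⁻¹) * sin (θs - θk) ^ 2 :=
    mul_nonneg (mul_nonneg (sub_nonneg.mpr h3) (sub_nonneg.mpr (inv_anti₀ h2 h1))) (sq_nonneg _)
  have hfrac : (σkx * σy + σky * σx) / (σx * σy) = σx⁻¹ * σkx + σy⁻¹ * σky := by
    field_simp
  rw [hval, hF, hSig, hSigk, rot_conj_diag_inv _ hx.ne' h2.ne', trace_rot_conj_diag_mul,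
    det_rot_conj_diag, det_rot_conj_diag, hfrac]
  linarith
end

section
/- Let σ_x, σ_y, σ_{k,x}, σ_{k,y} > 0 and θ_s, θ_k ∈ ℝ. Set α = σ_{k,x} σ_y + σ_{k,y} σ_x and β = σ_{k,x} σ_x + σ_{k,y} σ_y. Then tr( (R(θ_s) Λ R(θ_s)ᵀ)⁻¹ · (R(θ_k) Λ_k R(θ_k)ᵀ) ) = ( α + (β − α) · sin²(θ_s − θ_k) ) / (σ_x σ_y). -/
open Real Matrix

theorem stmt5 (σx σy σkx σky : ℝ) (h1 : σx > 0) (h2 : σy > 0)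
    (h3 : σkx > 0) (h4 : σky > 0) (θs θk : ℝ)
    (α β : ℝ) (hα : α = σkx * σy + σky * σx) (hβ : β = σkx * σx + σky * σy) :
    ((rot θs * !![σx, 0; 0, σy] * (rot θs)ᵀ)⁻¹
        * (rot θk * !![σkx, 0; 0, σky] * (rot θk)ᵀ)).trace
      = (α + (β - α) * Real.sin (θs - θk) ^ 2) / (σx * σy) := by
  have det_eq : (rot θs * !![σx, 0; 0, σy] * (rot θs)ᵀ).det = σx * σy := by
    have det_rot : (rot θs).det = 1 := by
      simp [rot, Matrix.det_fin_two_of, ← sq]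
    simp [Matrix.det_mul, Matrix.det_transpose, det_rot, Matrix.det_fin_two_of]
  have numerator_eq : α + (β - α) * Real.sin (θs - θk) ^ 2
      = α * Real.cos (θs - θk) ^ 2 + β * Real.sin (θs - θk) ^ 2 := by
    rw [Real.cos_sq']
    ring
  rw [numerator_eq, Matrix.inv_def, det_eq, Ring.inverse_eq_inv', Matrix.smul_mul,
    Matrix.trace_smul, smul_eq_mul, div_eq_inv_mul, Real.cos_sub, Real.sin_sub, hα, hβ]
  congr 1
  simp [rot, Matrix.adjugate_fin_two, Matrix.trace_fin_two, Matrix.vecMul, dotProduct]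
  ring
end
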